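/- For a ring A, the small finitistic dimension fin.dim A equals 0 if and only if Hom_{A^op}(M, A) ≠ 0 for every nonzero finitely presented left A-module M. -/

import Mathlib

set_option linter.unusedSectionVars false
set_option synthInstance.maxHeartbeats 1000000
set_option maxHeartbeats 1600000
set_option linter.unusedVariables false
set_option linter.unnecessarySeqFocus false

universe u
open MulOpposite Function DirectSum

/-! ### Lower triangular matrix rings -/

/-- The lower triangular matrix ring `[[A,0],[M,B]]` for a `B`-`A`-bimodule `M`
(a left `B`-module with a commuting right `A`-action, the latter written as a
left `Aᵐᵒᵖ`-action). The element `⟨a, m, b⟩` represents the matrix `[[a,0],[m,b]]`. -/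
@[ext] structure Tri (A B M : Type u) : Type u where
  a : A
  m : M
  b : B

namespace Tri
variable {A B M : Type u} [Ring A] [Ring B] [AddCommGroup M]
  [Module B M] [Module Aᵐᵒᵖ M] [SMulCommClass B Aᵐᵒᵖ M]

instance : Zero (Tri A B M) := ⟨⟨0, 0, 0⟩⟩
instance : Add (Tri A B M) := ⟨fun x y => ⟨x.a + y.a, x.m + y.m, x.b + y.b⟩⟩
instance : Neg (Tri A B M) := ⟨fun x => ⟨-x.a, -x.m, -x.b⟩⟩
instance : One (Tri A B M) := ⟨⟨1, 0, 1⟩⟩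
instance : Mul (Tri A B M) :=
  ⟨fun x y => ⟨x.a * y.a, op y.a • x.m + x.b • y.m, x.b * y.b⟩⟩

@[simp] lemma zero_a : (0 : Tri A B M).a = 0 := rfl
@[simp] lemma zero_m : (0 : Tri A B M).m = 0 := rfl
@[simp] lemma zero_b : (0 : Tri A B M).b = 0 := rfl
@[simp] lemma add_a (x y : Tri A B M) : (x + y).a = x.a + y.a := rfl
@[simp] lemma add_m (x y : Tri A B M) : (x + y).m = x.m + y.m := rfl
@[simp] lemma add_b (x y : Tri A B M) : (x + y).b = x.b + y.b := rfl
@[simp] lemma neg_a (x : Tri A B M) : (-x).a = -x.a := rfl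
@[simp] lemma neg_m (x : Tri A B M) : (-x).m = -x.m := rfl
@[simp] lemma neg_b (x : Tri A B M) : (-x).b = -x.b := rfl
@[simp] lemma one_a : (1 : Tri A B M).a = 1 := rfl
@[simp] lemma one_m : (1 : Tri A B M).m = 0 := rfl
@[simp] lemma one_b : (1 : Tri A B M).b = 1 := rfl
@[simp] lemma mul_a (x y : Tri A B M) : (x * y).a = x.a * y.a := rfl
@[simp] lemma mul_m (x y : Tri A B M) : (x * y).m = op y.a • x.m + x.b • y.m := rfl
@[simp] lemma mul_b (x y : Tri A B M) : (x * y).b = x.b * y.b := rfl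

instance : AddCommGroup (Tri A B M) where
  add_assoc x y z := by ext <;> simp [add_assoc]
  zero_add x := by ext <;> simp
  add_zero x := by ext <;> simp
  add_comm x y := by ext <;> simp [add_comm]
  neg_add_cancel x := by ext <;> simp
  nsmul := nsmulRec
  zsmul := zsmulRec

instance : Ring (Tri A B M) :=
  { (inferInstance : AddCommGroup (Tri A B M)),
    (inferInstance : Mul (Tri A B M)),
    (inferInstance : One (Tri A B M)) with
    left_distrib := fun x y z => by
      ext <;> simp [mul_add, smul_add, add_smul] <;> abel
    right_distrib := fun x y z => by
      ext <;> simp [add_mul, smul_add, add_smul] <;> abel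
    zero_mul := fun x => by ext <;> simp
    mul_zero := fun x => by ext <;> simp
    mul_assoc := fun x y z => by
      refine Tri.ext (mul_assoc _ _ _) ?_ (mul_assoc _ _ _)
      simp only [mul_m, mul_b, mul_a, smul_add, op_mul, mul_smul]
      rw [smul_comm x.b (op z.a) y.m]
      abel
    one_mul := fun x => by ext <;> simp
    mul_one := fun x => by ext <;> simp }

end Tri

/-! ### Corner rings -/

/-- The corner ring `eΛe` of a ring `Λ` at an idempotent `e`, with unit `e`. -/
def Corner {Λ : Type u} [Ring Λ] (e : Λ) (_ : IsIdempotentElem e) : Type u :=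
  {x : Λ // e * x = x ∧ x * e = x}

namespace Corner
variable {Λ : Type u} [Ring Λ] {e : Λ} {he : IsIdempotentElem e}

instance : Zero (Corner e he) := ⟨⟨0, by simp, by simp⟩⟩
instance : Add (Corner e he) :=
  ⟨fun x y => ⟨x.1 + y.1, by rw [mul_add, x.2.1, y.2.1], by rw [add_mul, x.2.2, y.2.2]⟩⟩
instance : Neg (Corner e he) :=
  ⟨fun x => ⟨-x.1, by rw [mul_neg, x.2.1], by rw [neg_mul, x.2.2]⟩⟩
instance : Mul (Corner e he) :=
  ⟨fun x y => ⟨x.1 * y.1, by rw [← mul_assoc, x.2.1], by rw [mul_assoc, y.2.2]⟩⟩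
instance : One (Corner e he) := ⟨⟨e, he, he⟩⟩

instance : Ring (Corner e he) where
  add_assoc x y z := Subtype.ext (add_assoc _ _ _)
  zero_add x := Subtype.ext (zero_add _)
  add_zero x := Subtype.ext (add_zero _)
  add_comm x y := Subtype.ext (add_comm _ _)
  neg_add_cancel x := Subtype.ext (neg_add_cancel _)
  nsmul := nsmulRec
  zsmul := zsmulRec
  left_distrib x y z := Subtype.ext (mul_add _ _ _)
  right_distrib x y z := Subtype.ext (add_mul _ _ _)
  zero_mul x := Subtype.ext (zero_mul _)
  mul_zero x := Subtype.ext (mul_zero _)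
  mul_assoc x y z := Subtype.ext (mul_assoc _ _ _)
  one_mul x := Subtype.ext x.2.1
  mul_one x := Subtype.ext x.2.2

end Corner

/-! ### Projective dimension and finitistic dimensions -/

/-- `pdLE R n M` : `M` has projective dimension at most `n` as a left `R`-module. -/
def pdLE (R : Type u) [Ring R] : (n : ℕ) → (M : Type u) → [AddCommGroup M] → [Module R M] → Prop
  | 0, M, _, _ => Module.Projective R M
  | n+1, M, _, _ => ∃ (P : Type u) (_ : AddCommGroup P) (_ : Module R P),
      Module.Projective R P ∧
      ∃ f : P →ₗ[R] M, Function.Surjective f ∧ pdLE R n (LinearMap.ker f)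

/-- The projective dimension of a left `R`-module, as an element of `ℕ∞`
(with value `⊤` when no finite projective resolution exists). -/
noncomputable def projDim (R : Type u) [Ring R] (M : Type u) [AddCommGroup M] [Module R M] : ℕ∞ :=
  sInf {d : ℕ∞ | ∃ n : ℕ, d = n ∧ pdLE R n M}

/-- `fgpdLE R n M` : `M` admits a resolution of length at most `n` by finitely
generated projective left `R`-modules. -/
def fgpdLE (R : Type u) [Ring R] :
    (n : ℕ) → (M : Type u) → [AddCommGroup M] → [Module R M] → Prop
  | 0, M, _, _ => Module.Projective R M ∧ Module.Finite R M
  | n+1, M, _, _ => ∃ (P : Type u) (_ : AddCommGroup P) (_ : Module R P),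
      (Module.Projective R P ∧ Module.Finite R P) ∧
      ∃ f : P →ₗ[R] M, Function.Surjective f ∧ fgpdLE R n (LinearMap.ker f)

/-- The small finitistic dimension of `R`, computed with *left* `R`-modules: the
supremum of the projective dimensions of the left modules admitting a finite
resolution by finitely generated projectives. -/
noncomputable def smallFinDimLeft (R : Type u) [Ring R] : ℕ∞ :=
  sSup {d : ℕ∞ | ∃ (M : Type u) (_ : AddCommGroup M) (_ : Module R M),
    (∃ n : ℕ, fgpdLE R n M) ∧ projDim R M = d}

/-- The big finitistic dimension of `R`, computed with *left* `R`-modules: the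
supremum of all finite projective dimensions of left `R`-modules. -/
noncomputable def bigFinDimLeft (R : Type u) [Ring R] : ℕ∞ :=
  sSup {d : ℕ∞ | d ≠ ⊤ ∧ ∃ (M : Type u) (_ : AddCommGroup M) (_ : Module R M),
    projDim R M = d}

/-- `fin.dim R` : the small finitistic dimension of `R`, computed with right
`R`-modules (= left `Rᵐᵒᵖ`-modules). -/
noncomputable def finDim (R : Type u) [Ring R] : ℕ∞ := smallFinDimLeft Rᵐᵒᵖ

/-- `Fin.dim R` : the big finitistic dimension of `R`, computed with right
`R`-modules (= left `Rᵐᵒᵖ`-modules). -/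
noncomputable def bigFinDim (R : Type u) [Ring R] : ℕ∞ := bigFinDimLeft Rᵐᵒᵖ

/-! ### Radical, socle, perfect and semilocal rings, Morita equivalence -/

/-- The radical of a module: the intersection of all maximal submodules. -/
def moduleRad (R M : Type u) [Ring R] [AddCommGroup M] [Module R M] : Submodule R M :=
  sInf {N : Submodule R M | IsCoatom N}

/-- The socle of a module: the sum of all simple submodules. -/
def moduleSoc (R M : Type u) [Ring R] [AddCommGroup M] [Module R M] : Submodule R M :=
  sSup {N : Submodule R M | IsSimpleModule R ↥N}

/-- A ring is right perfect if every right module has a projective cover,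
i.e. a superfluous epimorphism from a projective module. -/
def IsRightPerfect (R : Type u) [Ring R] : Prop :=
  ∀ (M : Type u) (_ : AddCommGroup M) (_ : Module Rᵐᵒᵖ M),
    ∃ (P : Type u) (_ : AddCommGroup P) (_ : Module Rᵐᵒᵖ P) (f : P →ₗ[Rᵐᵒᵖ] M),
      Module.Projective Rᵐᵒᵖ P ∧ Function.Surjective f ∧
      ∀ N : Submodule Rᵐᵒᵖ P, N ⊔ LinearMap.ker f = ⊤ → N = ⊤

/-- A ring is left perfect if every left module has a projective cover. -/
def IsLeftPerfect (R : Type u) [Ring R] : Prop :=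
  ∀ (M : Type u) (_ : AddCommGroup M) (_ : Module R M),
    ∃ (P : Type u) (_ : AddCommGroup P) (_ : Module R P) (f : P →ₗ[R] M),
      Module.Projective R P ∧ Function.Surjective f ∧
      ∀ N : Submodule R P, N ⊔ LinearMap.ker f = ⊤ → N = ⊤

/-- A ring is semilocal if its quotient by the Jacobson radical is semisimple;
equivalently, there is a surjective ring homomorphism onto a semisimple ring
whose kernel is the Jacobson radical. -/
def IsSemilocal (A : Type u) [Ring A] : Prop :=
  ∃ (T : Type u) (_ : Ring T) (f : A →+* T), Function.Surjective f ∧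
    IsSemisimpleRing T ∧ RingHom.ker f = (⊥ : Ideal A).jacobson

/-- Morita equivalence, via the categories of right modules. -/
def MoritaEquiv (R S : Type u) [Ring R] [Ring S] : Prop :=
  Nonempty (ModuleCat.{u} Rᵐᵒᵖ ≌ ModuleCat.{u} Sᵐᵒᵖ)

/-- Powers of an additive subgroup of a ring (e.g. of the Jacobson radical of a
not necessarily commutative ring), defined via products. -/
def addSubgroupPow {R : Type u} [Ring R] (I : AddSubgroup R) : ℕ → AddSubgroup R
  | 0 => ⊤
  | 1 => I
  | n+2 => AddSubgroup.closure {x : R | ∃ p ∈ I, ∃ q ∈ addSubgroupPow I (n+1), x = p * q}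

/-- Left multiplication by a fixed element, as an endomorphism of the right
regular module. -/
def leftMulHom (R : Type u) [Ring R] (z : R) : R →ₗ[Rᵐᵒᵖ] R where
  toFun x := z * x
  map_add' := mul_add z
  map_smul' r x := (mul_assoc z x r.unop).symm

/-! ### The asymmetric cover -/

/-- The endomorphism ring of the right `A`-module `S i`. -/
abbrev EndS (A : Type u) [Ring A] {ι : Type u} (S : ι → Type u)
    [∀ i, AddCommGroup (S i)] [∀ i, Module Aᵐᵒᵖ (S i)] (i : ι) : Type u :=
  Module.End Aᵐᵒᵖ (S i)

/-- `Ā = ∏_{S ∈ Σ(A)} T(End_A(S))`, the product over the simple right `A`-modules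
of the trivial extensions of their endomorphism rings. -/
abbrev Abar (A : Type u) [Ring A] {ι : Type u} (S : ι → Type u)
    [∀ i, AddCommGroup (S i)] [∀ i, Module Aᵐᵒᵖ (S i)] : Type u :=
  ∀ i, TrivSqZeroExt (EndS A S i) (EndS A S i)

/-- `S̄ = ⊕_{S ∈ Σ(A)} S`, the direct sum of the simple right `A`-modules. -/
abbrev Sbar (A : Type u) [Ring A] {ι : Type u} (S : ι → Type u)
    [∀ i, AddCommGroup (S i)] [∀ i, Module Aᵐᵒᵖ (S i)] : Type u :=
  ⨁ i, S i

/-- The canonical projection `T(B) → B` from a trivial extension, as a ring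
homomorphism. -/
def tszeFst (B : Type u) [Ring B] : TrivSqZeroExt B B →+* B where
  toFun x := x.fst
  map_one' := rfl
  map_mul' _ _ := rfl
  map_zero' := rfl
  map_add' _ _ := rfl

section
variable (A : Type u) [Ring A] {ι : Type u} (S : ι → Type u)
  [∀ i, AddCommGroup (S i)] [∀ i, Module Aᵐᵒᵖ (S i)]

/-- The left `Ā`-action on each simple module `S i`, via `Ā → T(End_A(S i)) → End_A(S i)`. -/
instance instModuleAbarS (i : ι) : Module (Abar A S) (S i) where
  smul r x := (r i).fst x
  one_smul x := rfl
  mul_smul r s x := rfl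
  smul_zero r := map_zero _
  smul_add r x y := map_add _ x y
  add_smul r s x := LinearMap.add_apply _ _ _
  zero_smul x := rfl

lemma abar_smul_def (r : Abar A S) (i : ι) (x : S i) : r • x = (r i).fst x := rfl

instance instSMulCommAbarS (i : ι) : SMulCommClass (Abar A S) Aᵐᵒᵖ (S i) where
  smul_comm r a x := map_smul ((r i).fst) a x

instance instSMulCommAbarSbar : SMulCommClass (Abar A S) Aᵐᵒᵖ (Sbar A S) where
  smul_comm r a x := by
    refine DFinsupp.ext fun i => ?_
    change r • a • x i = a • r • x i
    exact smul_comm _ _ _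

end

/-- The asymmetric cover `Ã = [[A,0],[S̄,Ā]]` of the ring `A`, relative to a
family `S : ι → Type u` of representatives of the simple right `A`-modules. -/
abbrev AsymCover (A : Type u) [Ring A] {ι : Type u} (S : ι → Type u)
    [∀ i, AddCommGroup (S i)] [∀ i, Module Aᵐᵒᵖ (S i)] : Type u :=
  Tri A (Abar A S) (Sbar A S)

/-- `S : ι → Type u` is a complete irredundant family of representatives of the
isomorphism classes of simple right `A`-modules. -/
def IsSimpleFamily (A : Type u) [Ring A] {ι : Type u} (S : ι → Type u)
    [∀ i, AddCommGroup (S i)] [∀ i, Module Aᵐᵒᵖ (S i)] : Prop :=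
  (∀ i, IsSimpleModule Aᵐᵒᵖ (S i)) ∧
  (∀ (T : Type u) (_ : AddCommGroup T) (_ : Module Aᵐᵒᵖ T),
    IsSimpleModule Aᵐᵒᵖ T → ∃ i, Nonempty (T ≃ₗ[Aᵐᵒᵖ] S i)) ∧
  (∀ i j, Nonempty (S i ≃ₗ[Aᵐᵒᵖ] S j) → i = j)

section RightLinear

open Matrix

/-- The regular right module of a ring, as a left module over the opposite ring. -/
def opRegularEquiv (A : Type u) [Ring A] : A ≃ₗ[Aᵐᵒᵖ] Aᵐᵒᵖ where
  toFun := op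
  invFun := unop
  map_add' _ _ := rfl
  map_smul' _ _ := rfl
  left_inv _ := rfl
  right_inv _ := rfl

instance regular_free_op (A : Type u) [Ring A] : Module.Free Aᵐᵒᵖ A :=
  Module.Free.of_equiv (opRegularEquiv A).symm

instance regular_finite_op (A : Type u) [Ring A] : Module.Finite Aᵐᵒᵖ A :=
  Module.Finite.equiv (opRegularEquiv A).symm

variable {A : Type u} [Ring A] {ι κ : Type} [Fintype ι] [Fintype κ]

/-- Multiplication of column vectors by a matrix, as a map of right modules. -/
def mulVecRight (G : Matrix κ ι A) : (ι → A) →ₗ[Aᵐᵒᵖ] (κ → A) where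
  toFun v := G *ᵥ v
  map_add' := G.mulVec_add
  map_smul' r v := G.mulVec_smul r v

lemma map_eq_mulVec [DecidableEq ι] (g : (ι → A) →ₗ[Aᵐᵒᵖ] (κ → A)) (v : ι → A) :
    g v = Matrix.of (fun j i => g (Pi.single i 1) j) *ᵥ v := by
  have hv : v = ∑ i, op (v i) • (Pi.single i (1 : A) : ι → A) := by
    ext k
    simp [Finset.sum_apply, Pi.single_apply]
  ext j
  conv_lhs => rw [hv, map_sum]
  simp [Finset.sum_apply, Matrix.mulVec, dotProduct]

lemma exists_mul_eq_one_iff_span_eq_top [DecidableEq ι] (G : Matrix κ ι A) :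
    (∃ H : Matrix ι κ A, H * G = 1) ↔ Submodule.span A (Set.range G) = ⊤ := by
  have key (H : Matrix ι κ A) (k : ι) : ∑ j, H k j • G j = (H * G) k := by
    ext i
    simp [Matrix.mul_apply, Finset.sum_apply]
  have hone (k : ι) : (1 : Matrix ι ι A) k = Pi.single k 1 := by
    ext i
    simp [Matrix.one_apply, Pi.single_apply, eq_comm]
  constructor
  · rintro ⟨H, hH⟩
    refine eq_top_iff.2 fun v _ => ?_
    rw [pi_eq_sum_univ' v]
    refine Submodule.sum_mem _ fun k _ => Submodule.smul_mem _ _ ?_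
    rw [← hone k, ← hH]
    exact (Submodule.mem_span_range_iff_exists_fun A).2 ⟨H k, key H k⟩
  · intro h
    have (k : ι) : ∃ c : κ → A, ∑ j, c j • G j = Pi.single k 1 :=
      (Submodule.mem_span_range_iff_exists_fun A).1 (h ▸ Submodule.mem_top)
    choose H hH using this
    exact ⟨Matrix.of H, funext fun k =>
      (key (Matrix.of H) k).symm.trans ((hH k).trans (hone k).symm)⟩

/-- Every nonzero finitely presented left module has a nonzero dual if and only if every
injective matrix (acting on columns) is left invertible. -/
lemma hom_ne_zero_iff_exists_mul_eq_one (A : Type u) [Ring A] :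
    (∀ (M : Type u) (_ : AddCommGroup M) (_ : Module A M),
        Module.FinitePresentation A M → Nontrivial M → ∃ f : M →ₗ[A] A, f ≠ 0) ↔
      ∀ (ι κ : Type) [Fintype ι] [Fintype κ] [DecidableEq ι] (G : Matrix κ ι A),
        (∀ v : ι → A, G *ᵥ v = 0 → v = 0) → ∃ H : Matrix ι κ A, H * G = 1 := by
  constructor
  · intro h ι κ _ _ _ G hG
    rw [exists_mul_eq_one_iff_span_eq_top]
    by_contra hK
    have hfp : Module.FinitePresentation A ((ι → A) ⧸ Submodule.span A (Set.range G)) := by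
      refine Module.finitePresentation_of_surjective _ (Submodule.mkQ_surjective _) ?_
      rw [Submodule.ker_mkQ]
      exact Submodule.fg_span (Set.finite_range G)
    obtain ⟨f, hf⟩ := h _ _ _ hfp (Submodule.Quotient.nontrivial_iff.2 hK)
    refine hf (Submodule.linearMap_qext _ ?_)
    set φ := f ∘ₗ (Submodule.span A (Set.range G)).mkQ with hφ
    have hsum (w : ι → A) : φ w = w ⬝ᵥ fun i => φ (Pi.single i 1) := by
      conv_lhs => rw [pi_eq_sum_univ' w, map_sum]
      simp [dotProduct]
    have hv := hG (fun i => φ (Pi.single i 1)) <| by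
      ext j
      rw [Matrix.mulVec, ← hsum, hφ, LinearMap.comp_apply, Submodule.mkQ_apply,
        (Submodule.Quotient.mk_eq_zero (Submodule.span A (Set.range G))).2
          (Submodule.subset_span (Set.mem_range_self j)), map_zero]
      rfl
    ext w
    rw [LinearMap.zero_comp, LinearMap.comp_apply]
    exact congrFun hv w
  · intro h M _ _ _ _
    obtain ⟨n, K, e, hK⟩ := Module.FinitePresentation.exists_fin A M
    obtain ⟨m, G, rfl⟩ := Submodule.fg_iff_exists_fin_generating_family.1 hK
    by_contra! hM
    have htop := (exists_mul_eq_one_iff_span_eq_top (Matrix.of G)).1 <|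
      h (Fin n) (Fin m) (Matrix.of G) fun v hv => by
        let φ : (Fin n → A) →ₗ[A] A := Fintype.linearCombination A v
        have hφ : Submodule.span A (Set.range G) ≤ LinearMap.ker φ := by
          rw [Submodule.span_le]
          rintro _ ⟨j, rfl⟩
          simpa [φ, Fintype.linearCombination_apply, Matrix.mulVec, dotProduct] using congrFun hv j
        have h0 := hM (Submodule.liftQ _ φ hφ ∘ₗ e.toLinearMap)
        ext i
        have := LinearMap.congr_fun h0 (e.symm (Submodule.Quotient.mk (Pi.single i 1)))
        simpa [φ, Fintype.linearCombination_apply_single] using this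
    have : Subsingleton ((Fin n → A) ⧸ Submodule.span A (Set.range G)) :=
      Submodule.Quotient.subsingleton_iff.2 htop
    exact not_subsingleton M e.toEquiv.subsingleton

lemma exists_retraction_of_mul_eq_one
    (h : ∀ (ι κ : Type) [Fintype ι] [Fintype κ] [DecidableEq ι] (G : Matrix κ ι A),
        (∀ v : ι → A, G *ᵥ v = 0 → v = 0) → ∃ H : Matrix ι κ A, H * G = 1)
    {P Q : Type u} [AddCommGroup P] [AddCommGroup Q] [Module Aᵐᵒᵖ P] [Module Aᵐᵒᵖ Q]
    [Module.Projective Aᵐᵒᵖ P] [Module.Projective Aᵐᵒᵖ Q]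
    [Module.Finite Aᵐᵒᵖ P] [Module.Finite Aᵐᵒᵖ Q]
    (g : Q →ₗ[Aᵐᵒᵖ] P) (hg : Injective g) :
    ∃ r : P →ₗ[Aᵐᵒᵖ] Q, r ∘ₗ g = LinearMap.id := by
  have cover (N : Type u) [AddCommGroup N] [Module Aᵐᵒᵖ N] [Module.Projective Aᵐᵒᵖ N]
      [Module.Finite Aᵐᵒᵖ N] : ∃ (n : ℕ) (p : (Fin n → A) →ₗ[Aᵐᵒᵖ] N) (s : N →ₗ[Aᵐᵒᵖ] (Fin n → A)),
        p ∘ₗ s = LinearMap.id := by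
    obtain ⟨n, f, hf⟩ := Module.Finite.exists_fin' Aᵐᵒᵖ N
    obtain ⟨s, hs⟩ := Module.projective_lifting_property f LinearMap.id hf
    let e : (Fin n → A) ≃ₗ[Aᵐᵒᵖ] (Fin n → Aᵐᵒᵖ) :=
      LinearEquiv.piCongrRight fun _ => opRegularEquiv A
    refine ⟨n, f ∘ₗ e.toLinearMap, e.symm.toLinearMap ∘ₗ s, ?_⟩
    ext x
    simpa using LinearMap.congr_fun hs x
  obtain ⟨m, p, s, hps⟩ := cover Q
  obtain ⟨n, p', s', hps'⟩ := cover P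
  replace hps := LinearMap.congr_fun hps
  replace hps' := LinearMap.congr_fun hps'
  simp only [LinearMap.comp_apply, LinearMap.id_apply] at hps hps'
  let e := LinearEquiv.sumArrowLequivProdArrow (Fin m) (Fin n) Aᵐᵒᵖ A
  let k : (Fin m → A) →ₗ[Aᵐᵒᵖ] (Fin m ⊕ Fin n → A) :=
    e.symm.toLinearMap ∘ₗ (LinearMap.id - s ∘ₗ p).prod (s' ∘ₗ g ∘ₗ p)
  obtain ⟨H, hH⟩ := h _ _ (Matrix.of fun j i => k (Pi.single i 1) j) fun v hv => by
    rw [← map_eq_mulVec, LinearMap.comp_apply, LinearEquiv.coe_coe,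
      LinearEquiv.map_eq_zero_iff] at hv
    obtain ⟨h1, h2⟩ := Prod.mk_eq_zero.1 hv
    have h3 : p v = 0 := by
      refine hg ?_
      rw [map_zero, ← hps' (g (p v))]
      exact (congrArg p' h2).trans (map_zero p')
    simpa [h3] using h1
  refine ⟨p ∘ₗ mulVecRight H ∘ₗ e.symm.toLinearMap ∘ₗ LinearMap.inr _ _ _ ∘ₗ s', ?_⟩
  ext q
  have hk : k (s q) = e.symm (0, s' (g q)) := by
    simp [k, hps]
  have hq : H *ᵥ k (s q) = s q := by
    rw [map_eq_mulVec k, Matrix.mulVec_mulVec, hH, Matrix.one_mulVec]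
  rw [hk] at hq
  exact (congrArg p hq).trans (hps q)

end RightLinear

lemma projDim_eq_zero_iff (R : Type u) [Ring R] (M : Type u) [AddCommGroup M] [Module R M] :
    projDim R M = 0 ↔ Module.Projective R M := by
  rw [projDim, ENat.sInf_eq_zero]
  constructor
  · rintro ⟨n, hn, h⟩
    obtain rfl : n = 0 := by exact_mod_cast hn.symm
    exact h
  · exact fun h => ⟨0, rfl, h⟩

lemma smallFinDimLeft_eq_zero_iff (R : Type u) [Ring R] :
    smallFinDimLeft R = 0 ↔ ∀ (M : Type u) (_ : AddCommGroup M) (_ : Module R M) (n : ℕ),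
      fgpdLE R n M → Module.Projective R M := by
  rw [smallFinDimLeft, ← bot_eq_zero, sSup_eq_bot]
  constructor
  · intro h M _ _ n hn
    exact (projDim_eq_zero_iff R M).1 (h _ ⟨M, _, _, ⟨n, hn⟩, rfl⟩)
  · rintro h _ ⟨M, _, _, ⟨n, hn⟩, rfl⟩
    exact (projDim_eq_zero_iff R M).2 (h M _ _ n hn)

/-- The small finitistic dimension vanishes if and only if every injective map between finitely
generated projective modules splits. -/
lemma smallFinDimLeft_eq_zero_iff_exists_retraction (R : Type u) [Ring R] :
    smallFinDimLeft R = 0 ↔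
      ∀ (P Q : Type u) [AddCommGroup P] [AddCommGroup Q] [Module R P] [Module R Q]
        [Module.Projective R P] [Module.Projective R Q] [Module.Finite R P] [Module.Finite R Q]
        (g : Q →ₗ[R] P), Injective g → ∃ r : P →ₗ[R] Q, r ∘ₗ g = LinearMap.id := by
  rw [smallFinDimLeft_eq_zero_iff]
  constructor
  · intro h P Q _ _ _ _ _ _ _ _ g hg
    have e : Q ≃ₗ[R] LinearMap.ker (LinearMap.range g).mkQ :=
      (LinearEquiv.ofInjective g hg).trans (LinearEquiv.ofEq _ _ (Submodule.ker_mkQ _).symm)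
    have := h (P ⧸ LinearMap.range g) _ _ 1 ⟨P, _, _, ⟨‹_›, ‹_›⟩, _, Submodule.mkQ_surjective _,
      Module.Projective.of_equiv e, Module.Finite.equiv e⟩
    obtain ⟨σ, hσ⟩ := Module.projective_lifting_property (LinearMap.range g).mkQ LinearMap.id
      (Submodule.mkQ_surjective _)
    let π : P →ₗ[R] LinearMap.range g :=
      (LinearMap.id - σ ∘ₗ (LinearMap.range g).mkQ).codRestrict _ fun x => by
        refine (Submodule.Quotient.eq (LinearMap.range g)).1 ?_
        exact (LinearMap.congr_fun hσ _).symm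
    refine ⟨(LinearEquiv.ofInjective g hg).symm.toLinearMap ∘ₗ π, LinearMap.ext fun q => ?_⟩
    have hq : π (g q) = LinearEquiv.ofInjective g hg q := by
      refine Subtype.ext ?_
      simp [π, (Submodule.Quotient.mk_eq_zero (LinearMap.range g)).2 ⟨q, rfl⟩]
    exact (LinearEquiv.symm_apply_eq _).2 hq
  · intro h M _ _ n hn
    suffices Module.Projective R M ∧ Module.Finite R M from this.1
    induction n generalizing M with
    | zero => exact hn
    | succ n ih =>
      obtain ⟨P, _, _, ⟨_, _⟩, f, hf, hker⟩ := hn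
      obtain ⟨_, _⟩ := ih _ _ _ hker
      obtain ⟨r, hr⟩ := h P (LinearMap.ker f) (LinearMap.ker f).subtype Subtype.val_injective
      refine ⟨?_, Module.Finite.of_surjective f hf⟩
      have hs : LinearMap.ker f ≤ LinearMap.ker (LinearMap.id - (LinearMap.ker f).subtype ∘ₗ r) :=
        fun x hx => by
          simpa [sub_eq_zero] using
            (congrArg Subtype.val (LinearMap.congr_fun hr ⟨x, hx⟩)).symm
      refine Module.Projective.of_split (Submodule.liftQ _ _ hs ∘ₗ
        (f.quotKerEquivOfSurjective hf).symm.toLinearMap) f (LinearMap.ext fun y => ?_)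
      obtain ⟨x, rfl⟩ := hf y
      have hx : (f.quotKerEquivOfSurjective hf).symm (f x) = Submodule.Quotient.mk x :=
        (LinearEquiv.symm_apply_eq _).2 rfl
      simp [hx]

/-- For a ring `A`, the small finitistic dimension of `A`
(computed with right `A`-modules) is zero if and only if every nonzero
finitely presented left `A`-module `M` satisfies `Hom_A(M,A) ≠ 0`. -/
theorem finDim_eq_zero_iff_hom_ne_zero (A : Type u) [Ring A] :
    finDim A = 0 ↔
      ∀ (M : Type u) (_ : AddCommGroup M) (_ : Module A M),
        Module.FinitePresentation A M → Nontrivial M → ∃ f : M →ₗ[A] A, f ≠ 0 := by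
  rw [hom_ne_zero_iff_exists_mul_eq_one, finDim, smallFinDimLeft_eq_zero_iff_exists_retraction]
  constructor
  · intro h ι κ _ _ _ G hG
    obtain ⟨r, hr⟩ := h (κ → A) (ι → A) (mulVecRight G) <|
      (injective_iff_map_eq_zero (mulVecRight G)).2 hG
    classical
    refine ⟨Matrix.of fun j i => r (Pi.single i 1) j, Matrix.ext_of_mulVec_single fun i => ?_⟩
    rw [← Matrix.mulVec_mulVec, ← map_eq_mulVec, Matrix.one_mulVec]
    exact LinearMap.congr_fun hr _
  · intro h P Q _ _ _ _ _ _ _ _ g hg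
    exact exists_retraction_of_mul_eq_one h g hg
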